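/- Let V : (0,2] → ℝ be defined by V(r) = 1/r³ − (113/100)/r⁶ + (523/1000)/r⁹. Then the cube is the unique global minimizer of E_V among 8-point configurations on the unit sphere S² ⊂ ℝ³: for every 8-point configuration C on S², E_V(C) ≥ E_V(cube), and equality holds only if C is the image of the cube configuration under an orthogonal transformation of ℝ³. -/

import Mathlib

open scoped Classical

/-- The `V`-potential energy of a finite configuration `C`:
`E_V(C) = (1/2) ∑_{x,y ∈ C, x ≠ y} V(|x-y|)`. -/
noncomputable def energy {n : ℕ} (V : ℝ → ℝ) (C : Finset (EuclideanSpace ℝ (Fin n))) : ℝ :=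
  (1 / 2) * ∑ x ∈ C, ∑ y ∈ C, if x = y then 0 else V (dist x y)

/-- The distance distribution of a finite configuration: `d_C(r)` is the number of
unordered pairs of distinct points of `C` at Euclidean distance `r`. -/
noncomputable def distDistrib {n : ℕ} (C : Finset (EuclideanSpace ℝ (Fin n))) : ℝ → ℝ :=
  fun r => ((C ×ˢ C).filter fun p => p.1 ≠ p.2 ∧ dist p.1 p.2 = r).card / 2

/-- `C` lies on the unit sphere `S^{n-1}`. -/
def onSphere {n : ℕ} (C : Finset (EuclideanSpace ℝ (Fin n))) : Prop :=
  ∀ x ∈ C, ‖x‖ = 1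

/-- `C'` is the image of `C` under an orthogonal transformation of `ℝ^n`. -/
def isOrthImage {n : ℕ} (C C' : Finset (EuclideanSpace ℝ (Fin n))) : Prop :=
  ∃ O : EuclideanSpace ℝ (Fin n) ≃ₗᵢ[ℝ] EuclideanSpace ℝ (Fin n), C' = C.image O

/-- The cube configuration: the 8 points `(±1/√3, ±1/√3, ±1/√3)` on the unit sphere `S²`. -/
noncomputable def cubeConfig : Finset (EuclideanSpace ℝ (Fin 3)) :=
  Finset.image (fun s : Fin 3 → Bool =>
    (WithLp.equiv 2 (Fin 3 → ℝ)).symm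
      (fun i => (if s i then 1 else -1) / Real.sqrt 3)) Finset.univ

/-- The potential function of Theorem 2 (the cube theorem). -/
noncomputable def cubeV : ℝ → ℝ :=
  fun r => 1 / r ^ 3 - (113 / 100) / r ^ 6 + (523 / 1000) / r ^ 9

/-! ### Legendre polynomials and their addition formulas on the sphere -/

/-- The Legendre polynomial of degree `2`. -/
noncomputable def legendreTwo (t : ℝ) : ℝ := (3 * t ^ 2 - 1) / 2

/-- The Legendre polynomial of degree `3`. -/
noncomputable def legendreThree (t : ℝ) : ℝ := (5 * t ^ 3 - 3 * t) / 2

/-- The Legendre polynomial of degree `5`. -/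
noncomputable def legendreFive (t : ℝ) : ℝ := (63 * t ^ 5 - 70 * t ^ 3 + 15 * t) / 8

lemma legendreTwo_addition {x y z u v w : ℝ} (h : x ^ 2 + y ^ 2 + z ^ 2 = 1)
    (h' : u ^ 2 + v ^ 2 + w ^ 2 = 1) :
    legendreTwo (x * u + y * v + z * w) =
      1 / 4 * ((3 * z ^ 2 - 1) * (3 * w ^ 2 - 1)) + 3 * ((z * x) * (w * u)) +
      3 * ((z * y) * (w * v)) + 3 / 4 * ((x ^ 2 - y ^ 2) * (u ^ 2 - v ^ 2)) +
      3 / 4 * ((2 * x * y) * (2 * u * v)) := by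
  have key : ∀ m n : ℝ, x ^ 2 + y ^ 2 + z ^ 2 = m → u ^ 2 + v ^ 2 + w ^ 2 = n →
      (3 * (x * u + y * v + z * w) ^ 2 - m * n) / 2 =
      1 / 4 * ((3 * z ^ 2 - m) * (3 * w ^ 2 - n)) + 3 * ((z * x) * (w * u)) +
      3 * ((z * y) * (w * v)) + 3 / 4 * ((x ^ 2 - y ^ 2) * (u ^ 2 - v ^ 2)) +
      3 / 4 * ((2 * x * y) * (2 * u * v)) := by
    rintro m n rfl rfl
    ring
  simpa [legendreTwo] using key 1 1 h h'

lemma legendreThree_addition {x y z u v w : ℝ} (h : x ^ 2 + y ^ 2 + z ^ 2 = 1)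
    (h' : u ^ 2 + v ^ 2 + w ^ 2 = 1) :
    legendreThree (x * u + y * v + z * w) =
      1 / 4 * ((5 * z ^ 3 - 3 * z) * (5 * w ^ 3 - 3 * w)) +
      3 / 8 * (((5 * z ^ 2 - 1) * x) * ((5 * w ^ 2 - 1) * u)) +
      3 / 8 * (((5 * z ^ 2 - 1) * y) * ((5 * w ^ 2 - 1) * v)) +
      15 / 4 * ((z * (x ^ 2 - y ^ 2)) * (w * (u ^ 2 - v ^ 2))) +
      15 / 4 * ((z * (2 * x * y)) * (w * (2 * u * v))) +
      5 / 8 * ((x ^ 3 - 3 * x * y ^ 2) * (u ^ 3 - 3 * u * v ^ 2)) +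
      5 / 8 * ((3 * x ^ 2 * y - y ^ 3) * (3 * u ^ 2 * v - v ^ 3)) := by
  have key : ∀ m n : ℝ, x ^ 2 + y ^ 2 + z ^ 2 = m → u ^ 2 + v ^ 2 + w ^ 2 = n →
      (5 * (x * u + y * v + z * w) ^ 3 - 3 * (x * u + y * v + z * w) * m * n) / 2 =
      1 / 4 * ((5 * z ^ 3 - 3 * z * m) * (5 * w ^ 3 - 3 * w * n)) +
      3 / 8 * (((5 * z ^ 2 - m) * x) * ((5 * w ^ 2 - n) * u)) +
      3 / 8 * (((5 * z ^ 2 - m) * y) * ((5 * w ^ 2 - n) * v)) +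
      15 / 4 * ((z * (x ^ 2 - y ^ 2)) * (w * (u ^ 2 - v ^ 2))) +
      15 / 4 * ((z * (2 * x * y)) * (w * (2 * u * v))) +
      5 / 8 * ((x ^ 3 - 3 * x * y ^ 2) * (u ^ 3 - 3 * u * v ^ 2)) +
      5 / 8 * ((3 * x ^ 2 * y - y ^ 3) * (3 * u ^ 2 * v - v ^ 3)) := by
    rintro m n rfl rfl
    ring
  simpa [legendreThree] using key 1 1 h h'

lemma legendreFive_addition {x y z u v w : ℝ} (h : x ^ 2 + y ^ 2 + z ^ 2 = 1)
    (h' : u ^ 2 + v ^ 2 + w ^ 2 = 1) :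
    legendreFive (x * u + y * v + z * w) =
      1 / 64 * ((63 * z ^ 5 - 70 * z ^ 3 + 15 * z) * (63 * w ^ 5 - 70 * w ^ 3 + 15 * w)) +
      15 / 64 * (((21 * z ^ 4 - 14 * z ^ 2 + 1) * x) * ((21 * w ^ 4 - 14 * w ^ 2 + 1) * u)) +
      15 / 64 * (((21 * z ^ 4 - 14 * z ^ 2 + 1) * y) * ((21 * w ^ 4 - 14 * w ^ 2 + 1) * v)) +
      105 / 16 * (((3 * z ^ 3 - z) * (x ^ 2 - y ^ 2)) * ((3 * w ^ 3 - w) * (u ^ 2 - v ^ 2))) +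
      105 / 16 * (((3 * z ^ 3 - z) * (2 * x * y)) * ((3 * w ^ 3 - w) * (2 * u * v))) +
      35 / 128 * (((9 * z ^ 2 - 1) * (x ^ 3 - 3 * x * y ^ 2)) *
        ((9 * w ^ 2 - 1) * (u ^ 3 - 3 * u * v ^ 2))) +
      35 / 128 * (((9 * z ^ 2 - 1) * (3 * x ^ 2 * y - y ^ 3)) *
        ((9 * w ^ 2 - 1) * (3 * u ^ 2 * v - v ^ 3))) +
      315 / 64 * ((z * (x ^ 4 - 6 * x ^ 2 * y ^ 2 + y ^ 4)) *
        (w * (u ^ 4 - 6 * u ^ 2 * v ^ 2 + v ^ 4))) +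
      315 / 64 * ((z * (4 * x ^ 3 * y - 4 * x * y ^ 3)) *
        (w * (4 * u ^ 3 * v - 4 * u * v ^ 3))) +
      63 / 128 * ((x ^ 5 - 10 * x ^ 3 * y ^ 2 + 5 * x * y ^ 4) *
        (u ^ 5 - 10 * u ^ 3 * v ^ 2 + 5 * u * v ^ 4)) +
      63 / 128 * ((5 * x ^ 4 * y - 10 * x ^ 2 * y ^ 3 + y ^ 5) *
        (5 * u ^ 4 * v - 10 * u ^ 2 * v ^ 3 + v ^ 5)) := by
  have key : ∀ m n : ℝ, x ^ 2 + y ^ 2 + z ^ 2 = m → u ^ 2 + v ^ 2 + w ^ 2 = n →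
      (63 * (x * u + y * v + z * w) ^ 5 - 70 * (x * u + y * v + z * w) ^ 3 * m * n +
        15 * (x * u + y * v + z * w) * m ^ 2 * n ^ 2) / 8 =
      1 / 64 * ((63 * z ^ 5 - 70 * z ^ 3 * m + 15 * z * m ^ 2) *
        (63 * w ^ 5 - 70 * w ^ 3 * n + 15 * w * n ^ 2)) +
      15 / 64 * (((21 * z ^ 4 - 14 * z ^ 2 * m + m ^ 2) * x) *
        ((21 * w ^ 4 - 14 * w ^ 2 * n + n ^ 2) * u)) +
      15 / 64 * (((21 * z ^ 4 - 14 * z ^ 2 * m + m ^ 2) * y) *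
        ((21 * w ^ 4 - 14 * w ^ 2 * n + n ^ 2) * v)) +
      105 / 16 * (((3 * z ^ 3 - z * m) * (x ^ 2 - y ^ 2)) *
        ((3 * w ^ 3 - w * n) * (u ^ 2 - v ^ 2))) +
      105 / 16 * (((3 * z ^ 3 - z * m) * (2 * x * y)) * ((3 * w ^ 3 - w * n) * (2 * u * v))) +
      35 / 128 * (((9 * z ^ 2 - m) * (x ^ 3 - 3 * x * y ^ 2)) *
        ((9 * w ^ 2 - n) * (u ^ 3 - 3 * u * v ^ 2))) +
      35 / 128 * (((9 * z ^ 2 - m) * (3 * x ^ 2 * y - y ^ 3)) *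
        ((9 * w ^ 2 - n) * (3 * u ^ 2 * v - v ^ 3))) +
      315 / 64 * ((z * (x ^ 4 - 6 * x ^ 2 * y ^ 2 + y ^ 4)) *
        (w * (u ^ 4 - 6 * u ^ 2 * v ^ 2 + v ^ 4))) +
      315 / 64 * ((z * (4 * x ^ 3 * y - 4 * x * y ^ 3)) *
        (w * (4 * u ^ 3 * v - 4 * u * v ^ 3))) +
      63 / 128 * ((x ^ 5 - 10 * x ^ 3 * y ^ 2 + 5 * x * y ^ 4) *
        (u ^ 5 - 10 * u ^ 3 * v ^ 2 + 5 * u * v ^ 4)) +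
      63 / 128 * ((5 * x ^ 4 * y - 10 * x ^ 2 * y ^ 3 + y ^ 5) *
        (5 * u ^ 4 * v - 10 * u ^ 2 * v ^ 3 + v ^ 5)) := by
    rintro m n rfl rfl
    ring
  simpa [legendreFive] using key 1 1 h h'

/-! ### Numerical bounds -/

lemma sqrt_two_bounds : 14142135623 / 10000000000 < √2 ∧ √2 < 14142135624 / 10000000000 :=
  ⟨Real.lt_sqrt_of_sq_lt (by norm_num), (Real.sqrt_lt' (by norm_num)).2 (by norm_num)⟩

lemma sqrt_three_bounds : 17320508075 / 10000000000 < √3 ∧ √3 < 17320508076 / 10000000000 :=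
  ⟨Real.lt_sqrt_of_sq_lt (by norm_num), (Real.sqrt_lt' (by norm_num)).2 (by norm_num)⟩

lemma sqrt_six_bounds : 24494897427 / 10000000000 < √6 ∧ √6 < 24494897428 / 10000000000 :=
  ⟨Real.lt_sqrt_of_sq_lt (by norm_num), (Real.sqrt_lt' (by norm_num)).2 (by norm_num)⟩

/-! ### The interpolating polynomial -/

/-- The degree `0` Legendre coefficient of the polynomial interpolating `cubeV` at the cube. -/
noncomputable def interpCoeffZero : ℝ :=
  -247131 / 409600 + 1894719 / 4096000 * √3 + 7637637 / 262144000 * √6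

/-- The degree `1` Legendre coefficient of the polynomial interpolating `cubeV` at the cube. -/
noncomputable def interpCoeffOne : ℝ :=
  -197986057 / 143360000 + 126395457 / 143360000 * √3 + 279517839 / 9175040000 * √6

/-- The degree `2` Legendre coefficient of the polynomial interpolating `cubeV` at the cube. -/
noncomputable def interpCoeffTwo : ℝ :=
  -82377 / 81920 + 2871801 / 4096000 * √3 - 14967801 / 262144000 * √6

/-- The degree `3` Legendre coefficient of the polynomial interpolating `cubeV` at the cube. -/
noncomputable def interpCoeffThree : ℝ :=
  -2515041 / 5120000 + 4396869 / 20480000 * √3 + 68738733 / 1310720000 * √6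

/-- The degree `5` Legendre coefficient of the polynomial interpolating `cubeV` at the cube. -/
noncomputable def interpCoeffFive : ℝ :=
  4443273 / 28672000 + 482733 / 7168000 * √3 - 101724471 / 917504000 * √6

/-- The polynomial in the inner product `t` that agrees with `cubeV` at `t = -1` and agrees with it
to second order at `t = ±1/3`. -/
noncomputable def interpPoly (t : ℝ) : ℝ :=
  interpCoeffZero + interpCoeffOne * t + interpCoeffTwo * legendreTwo t +
    interpCoeffThree * legendreThree t + interpCoeffFive * legendreFive t

/-- The cofactor of the forced zeros in `cubeV - interpPoly`, in the variable `s = √3 / 2 * r`. -/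
noncomputable def gapCofactor (s : ℝ) : ℝ :=
  (42363 / 1024000) +
    (42363 / 512000 + 42363 / 1024000 * √2 + 14121 / 1024000 * √3) * s +
    (409509 / 2048000 + 42363 / 512000 * √2 + 14121 / 512000 * √3 + 14121 / 1024000 * √6) * s ^ 2 +
    (324783 / 1024000 + 183573 / 1024000 * √2 - 26217 / 2048000 * √3 + 14121 / 512000 * √6) * s ^ 3 +
    (70767 / 163840 + 14121 / 51200 * √2 - 54459 / 1024000 * √3 - 20169 / 1024000 * √6) * s ^ 4 +
    (1119609 / 2048000 + 1402029 / 4096000 * √2 - 174951 / 819200 * √3 - 3429 / 51200 * √6) * s ^ 5 +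
    (6268029 / 8192000 + 837189 / 2048000 * √2 - 765837 / 2048000 * √3 - 834417 / 4096000 * √6) * s ^ 6 +
    (4028811 / 4096000 + 2433 / 4096 * √2 - 4907617 / 8192000 * √3 - 697257 / 2048000 * √6) * s ^ 7 +
    (4724567 / 3276800 + 1595811 / 2048000 * √2 - 3375943 / 4096000 * √3 - 10183 / 20480 * √6) * s ^ 8 +
    (6032173 / 8192000 + 76859881 / 65536000 * √2 - 23817277 / 49152000 * √3 - 1339343 / 2048000 * √6) * s ^ 9 +
    (1769801 / 1966080 + 2638949 / 6553600 * √2 - 13094659 / 24576000 * √3 - 44558167 / 196608000 * √6) * s ^ 10 +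
    (8499049 / 12288000 - 17582491 / 196608000 * √2 - 204131 / 3276800 * √3 - 18401863 / 98304000 * √6) * s ^ 11 +
    (1945587 / 8192000 - 18285059 / 49152000 * √2 + 3491279 / 12288000 * √3 - 16393033 / 196608000 * √6) * s ^ 12 +
    (-815519 / 1536000 + 2311549 / 98304000 * √2 + 31363 / 196608 * √3 + 1479061 / 16384000 * √6) * s ^ 13 +
    (-493697 / 3072000 - 17879 / 256000 * √3 + 3767573 / 32768000 * √6) * s ^ 14

lemma gapCofactor_pos {s : ℝ} (hs : 0 < s) (hs' : s ≤ √3) : 0 < gapCofactor s := by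
  obtain ⟨h2l, h2u⟩ := sqrt_two_bounds
  obtain ⟨h3l, h3u⟩ := sqrt_three_bounds
  obtain ⟨h6l, h6u⟩ := sqrt_six_bounds
  have hM : s ≤ 17321 / 10000 := by linarith
  have hpow : ∀ n : ℕ, s ^ (6 + n) ≤ s ^ 6 * (17321 / 10000) ^ n := fun n => by
    rw [pow_add]; gcongr
  have hpow' : ∀ n ≤ 6, s ^ 6 ≤ s ^ (6 - n) * (17321 / 10000) ^ n := fun n hn => by
    nth_rewrite 1 [← Nat.sub_add_cancel hn]
    rw [pow_add]; gcongr
  unfold gapCofactor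
  have c0 : (0 : ℝ) ≤ 42363 / 1024000 := by
    linarith
  have c1 : (0 : ℝ) ≤ 42363 / 512000 + 42363 / 1024000 * √2 + 14121 / 1024000 * √3 := by
    linarith
  have c2 : (0 : ℝ) ≤ 409509 / 2048000 + 42363 / 512000 * √2 + 14121 / 512000 * √3 + 14121 / 1024000 * √6 := by
    linarith
  have c3 : (61607 / 100000 : ℝ) ≤ 324783 / 1024000 + 183573 / 1024000 * √2 - 26217 / 2048000 * √3 + 14121 / 512000 * √6 := by
    linarith
  have c4 : (68159 / 100000 : ℝ) ≤ 70767 / 163840 + 14121 / 51200 * √2 - 54459 / 1024000 * √3 - 20169 / 1024000 * √6 := by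
    linarith
  have c5 : (49679 / 100000 : ℝ) ≤ 1119609 / 2048000 + 1402029 / 4096000 * √2 - 174951 / 819200 * √3 - 3429 / 51200 * √6 := by
    linarith
  have c6 : (9827 / 50000 : ℝ) ≤ 6268029 / 8192000 + 837189 / 2048000 * √2 - 765837 / 2048000 * √3 - 834417 / 4096000 * √6 := by
    linarith
  have c7 : (-1199 / 25000 : ℝ) ≤ 4028811 / 4096000 + 2433 / 4096 * √2 - 4907617 / 8192000 * √3 - 697257 / 2048000 * √6 := by
    linarith
  have c8 : (-2543 / 25000 : ℝ) ≤ 4724567 / 3276800 + 1595811 / 2048000 * √2 - 3375943 / 4096000 * √3 - 10183 / 20480 * √6 := by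
    linarith
  have c9 : (-4629 / 100000 : ℝ) ≤ 6032173 / 8192000 + 76859881 / 65536000 * √2 - 23817277 / 49152000 * √3 - 1339343 / 2048000 * √6 := by
    linarith
  have c10 : (-21 / 2500 : ℝ) ≤ 1769801 / 1966080 + 2638949 / 6553600 * √2 - 13094659 / 24576000 * √3 - 44558167 / 196608000 * √6 := by
    linarith
  have c11 : (-63 / 50000 : ℝ) ≤ 8499049 / 12288000 - 17582491 / 196608000 * √2 - 204131 / 3276800 * √3 - 18401863 / 98304000 * √6 := by
    linarith
  have c12 : (-73 / 100000 : ℝ) ≤ 1945587 / 8192000 - 18285059 / 49152000 * √2 + 3491279 / 12288000 * √3 - 16393033 / 196608000 * √6 := by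
    linarith
  have c13 : (-13 / 50000 : ℝ) ≤ -815519 / 1536000 + 2311549 / 98304000 * √2 + 31363 / 196608 * √3 + 1479061 / 16384000 * √6 := by
    linarith
  have c14 : (-41 / 1000000 : ℝ) ≤ -493697 / 3072000 - 17879 / 256000 * √3 + 3767573 / 32768000 * √6 := by
    linarith
  have e1 := mul_le_mul_of_nonneg_right c1 (pow_nonneg hs.le 1)
  have e2 := mul_le_mul_of_nonneg_right c2 (pow_nonneg hs.le 2)
  have e3 := mul_le_mul_of_nonneg_right c3 (pow_nonneg hs.le 3)
  have e4 := mul_le_mul_of_nonneg_right c4 (pow_nonneg hs.le 4)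
  have e5 := mul_le_mul_of_nonneg_right c5 (pow_nonneg hs.le 5)
  have e6 := mul_le_mul_of_nonneg_right c6 (pow_nonneg hs.le 6)
  have e7 := mul_le_mul_of_nonneg_right c7 (pow_nonneg hs.le 7)
  have e8 := mul_le_mul_of_nonneg_right c8 (pow_nonneg hs.le 8)
  have e9 := mul_le_mul_of_nonneg_right c9 (pow_nonneg hs.le 9)
  have e10 := mul_le_mul_of_nonneg_right c10 (pow_nonneg hs.le 10)
  have e11 := mul_le_mul_of_nonneg_right c11 (pow_nonneg hs.le 11)
  have e12 := mul_le_mul_of_nonneg_right c12 (pow_nonneg hs.le 12)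
  have e13 := mul_le_mul_of_nonneg_right c13 (pow_nonneg hs.le 13)
  have e14 := mul_le_mul_of_nonneg_right c14 (pow_nonneg hs.le 14)
  have u3 := hpow' 3 (by norm_num)
  have u4 := hpow' 2 (by norm_num)
  have u5 := hpow' 1 (by norm_num)
  have u7 := hpow 1
  have u8 := hpow 2
  have u9 := hpow 3
  have u10 := hpow 4
  have u11 := hpow 5
  have u12 := hpow 6
  have u13 := hpow 7
  have u14 := hpow 8
  have h6 : 0 < s ^ 6 := by positivity
  norm_num at u3 u4 u5 u7 u8 u9 u10 u11 u12 u13 u14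
  linarith

lemma interpCoeff_pos :
    0 < interpCoeffOne ∧ 0 < interpCoeffTwo ∧ 0 < interpCoeffThree ∧ 0 < interpCoeffFive := by
  obtain ⟨h2l, h2u⟩ := sqrt_two_bounds
  obtain ⟨h3l, h3u⟩ := sqrt_three_bounds
  obtain ⟨h6l, h6u⟩ := sqrt_six_bounds
  unfold interpCoeffOne interpCoeffTwo interpCoeffThree interpCoeffFive
  refine ⟨?_, ?_, ?_, ?_⟩ <;> linarith

lemma gap_identity (s : ℝ) :
    3 / 8 * √3 * s ^ 6 - 3051 / 6400 * s ^ 3 + 42363 / 512000 * √3 -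
        s ^ 9 * interpPoly (1 - 2 / 3 * s ^ 2) =
      (s - 1) ^ 2 * (s - √2) ^ 2 * (√3 - s) * gapCofactor s := by
  have h6 : √6 = √2 * √3 := by rw [← Real.sqrt_mul (by norm_num)]; norm_num
  have h2 : √2 ^ 2 = 2 := Real.sq_sqrt (by norm_num)
  have h3 : √3 ^ 2 = 3 := Real.sq_sqrt (by norm_num)
  have h2' : √2 ^ 3 = 2 * √2 := by rw [pow_succ, h2]
  unfold interpPoly gapCofactor legendreTwo legendreThree legendreFive
  unfold interpCoeffZero interpCoeffOne interpCoeffTwo interpCoeffThree interpCoeffFive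
  rw [h6]
  generalize √2 = a at *
  generalize √3 = b at *
  ring_nf
  simp only [h2, h3, h2']
  ring

lemma cubeV_sub_interpPoly {r : ℝ} (hr : 0 < r) :
    cubeV r - interpPoly (1 - r ^ 2 / 2) =
      (√3 / 2 * r - 1) ^ 2 * (√3 / 2 * r - √2) ^ 2 * (√3 - √3 / 2 * r) *
        gapCofactor (√3 / 2 * r) / (√3 / 2 * r) ^ 9 := by
  have h3 : √3 ^ 2 = 3 := Real.sq_sqrt (by norm_num)
  have h3pos : 0 < √3 := by positivity
  rw [← gap_identity]
  have ht : 1 - 2 / 3 * (√3 / 2 * r) ^ 2 = 1 - r ^ 2 / 2 := by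
    rw [mul_pow, div_pow, h3]; ring
  rw [ht, sub_div, mul_div_cancel_left₀ _ (by positivity)]
  congr 1
  have h9 : √3 ^ 9 = 81 * √3 := by
    rw [show √3 ^ 9 = (√3 ^ 2) ^ 4 * √3 by ring, h3]; norm_num
  have hp3 : √3 ^ 3 = 3 * √3 := by
    rw [show √3 ^ 3 = (√3 ^ 2) * √3 by ring, h3]
  have h6 : √3 ^ 6 = 27 := by
    rw [show √3 ^ 6 = (√3 ^ 2) ^ 3 by ring, h3]; norm_num
  unfold cubeV
  simp only [mul_pow, div_pow, h9, h6, hp3]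
  field_simp
  ring

lemma interpPoly_le_cubeV {r : ℝ} (hr : 0 < r) (hr' : r ≤ 2) :
    interpPoly (1 - r ^ 2 / 2) ≤ cubeV r := by
  have h3 : 0 < √3 := by positivity
  have hs : √3 / 2 * r ≤ √3 := by nlinarith
  have hq := gapCofactor_pos (s := √3 / 2 * r) (by positivity) hs
  have h0 : 0 ≤ √3 - √3 / 2 * r := by linarith
  rw [← sub_nonneg, cubeV_sub_interpPoly hr]
  positivity

lemma inner_eq_of_cubeV_eq {r t : ℝ} (hr : 0 < r) (hr' : r ≤ 2) (ht : t = 1 - r ^ 2 / 2)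
    (h : cubeV r = interpPoly t) : t = 1 / 3 ∨ t = -1 / 3 ∨ t = -1 := by
  have h3 : 0 < √3 := by positivity
  have h3' : √3 ^ 2 = 3 := Real.sq_sqrt (by norm_num)
  have h2 : √2 ^ 2 = 2 := Real.sq_sqrt (by norm_num)
  have hs : √3 / 2 * r ≤ √3 := by nlinarith
  have hq := gapCofactor_pos (s := √3 / 2 * r) (by positivity) hs
  have hid := cubeV_sub_interpPoly hr
  rw [← ht, h, sub_self, eq_comm, div_eq_zero_iff] at hid
  have hs9 : (√3 / 2 * r) ^ 9 ≠ 0 := by positivity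
  have hst : t = 1 - 2 / 3 * (√3 / 2 * r) ^ 2 := by
    rw [ht, mul_pow, div_pow, h3']; ring
  simp only [hs9, hq.ne', or_false, mul_eq_zero, pow_eq_zero_iff, ne_eq, OfNat.ofNat_ne_zero,
    not_false_eq_true] at hid
  rcases hid with (hid | hid) | hid
  · left; rw [hst, sub_eq_zero.1 hid]; norm_num
  · right; left; rw [hst, sub_eq_zero.1 hid, h2]; norm_num
  · right; right; rw [hst, ← sub_eq_zero.1 hid, h3']; norm_num

lemma cubeV_eq_interpPoly {r t : ℝ} (hr : 0 < r) (ht : t = 1 - r ^ 2 / 2)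
    (h : t = 1 / 3 ∨ t = -1 / 3 ∨ t = -1) : cubeV r = interpPoly t := by
  have h3 : √3 ^ 2 = 3 := Real.sq_sqrt (by norm_num)
  have h2 : √2 ^ 2 = 2 := Real.sq_sqrt (by norm_num)
  have hs : 0 ≤ √3 / 2 * r := by positivity
  have hst : (√3 / 2 * r) ^ 2 = 3 / 2 * (1 - t) := by
    rw [ht, mul_pow, div_pow, h3]; ring
  have hid := cubeV_sub_interpPoly hr
  rw [← ht] at hid
  rw [← sub_eq_zero, hid]
  rcases h with h | h | h
  · have : √3 / 2 * r = 1 := by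
      rw [← pow_left_inj₀ hs (by norm_num) two_ne_zero, hst, h]; norm_num
    simp [this]
  · have : √3 / 2 * r = √2 := by
      rw [← pow_left_inj₀ hs (by positivity) two_ne_zero, hst, h, h2]; norm_num
    simp [this]
  · have : √3 / 2 * r = √3 := by
      rw [← pow_left_inj₀ hs (by positivity) two_ne_zero, hst, h, h3]; norm_num
    simp [this]

/-! ### Energy of spherical configurations -/

section Energy

local notation "E3" => EuclideanSpace ℝ (Fin 3)

lemma sq_coords_of_norm_eq_one {x : E3} (hx : ‖x‖ = 1) : x 0 ^ 2 + x 1 ^ 2 + x 2 ^ 2 = 1 := by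
  have h := EuclideanSpace.real_norm_sq_eq x
  rw [hx, Fin.sum_univ_three] at h
  linarith

lemma inner_eq_coords (x y : E3) : inner ℝ x y = x 0 * y 0 + x 1 * y 1 + x 2 * y 2 := by
  simp [PiLp.inner_apply, Fin.sum_univ_three, mul_comm]

lemma inner_eq_one_sub_dist_sq {x y : E3} (hx : ‖x‖ = 1) (hy : ‖y‖ = 1) :
    inner ℝ x y = 1 - dist x y ^ 2 / 2 := by
  rw [dist_eq_norm, norm_sub_sq_real, hx, hy]
  ring

lemma sum_sum_mul_eq {α : Type*} (C : Finset α) (w : ℝ) (f : α → ℝ) :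
    ∑ x ∈ C, ∑ y ∈ C, w * (f x * f y) = w * (∑ x ∈ C, f x) ^ 2 := by
  simp only [← Finset.mul_sum, sq, Finset.sum_mul_sum]

lemma sum_sum_mul_nonneg {α : Type*} (C : Finset α) {w : ℝ} (hw : 0 ≤ w) (f : α → ℝ) :
    0 ≤ ∑ x ∈ C, ∑ y ∈ C, w * (f x * f y) := by
  rw [sum_sum_mul_eq]
  positivity

lemma sum_inner_eq_norm_sq (C : Finset E3) :
    ∑ x ∈ C, ∑ y ∈ C, inner ℝ x y = ‖∑ x ∈ C, x‖ ^ 2 := by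
  rw [← real_inner_self_eq_norm_sq, sum_inner]
  simp only [inner_sum]

lemma sum_legendreTwo_eq {C : Finset E3} (hC : onSphere C) :
    ∑ x ∈ C, ∑ y ∈ C, legendreTwo (inner ℝ x y) =
      1 / 4 * (∑ x ∈ C, (3 * x 2 ^ 2 - 1)) ^ 2 + 3 * (∑ x ∈ C, x 2 * x 0) ^ 2 +
        3 * (∑ x ∈ C, x 2 * x 1) ^ 2 + 3 / 4 * (∑ x ∈ C, (x 0 ^ 2 - x 1 ^ 2)) ^ 2 +
        3 / 4 * (∑ x ∈ C, 2 * x 0 * x 1) ^ 2 := by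
  simp only [← sum_sum_mul_eq, ← Finset.sum_add_distrib]
  refine Finset.sum_congr rfl fun x hx => Finset.sum_congr rfl fun y hy => ?_
  rw [inner_eq_coords]
  exact legendreTwo_addition (sq_coords_of_norm_eq_one (hC x hx))
    (sq_coords_of_norm_eq_one (hC y hy))

lemma sum_legendreTwo_nonneg {C : Finset E3} (hC : onSphere C) :
    0 ≤ ∑ x ∈ C, ∑ y ∈ C, legendreTwo (inner ℝ x y) := by
  rw [sum_legendreTwo_eq hC]
  positivity

lemma sum_legendreThree_nonneg {C : Finset E3} (hC : onSphere C) :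
    0 ≤ ∑ x ∈ C, ∑ y ∈ C, legendreThree (inner ℝ x y) := by
  rw [Finset.sum_congr rfl fun x hx => Finset.sum_congr rfl fun y hy =>
    (congrArg legendreThree (inner_eq_coords x y)).trans <| legendreThree_addition
      (sq_coords_of_norm_eq_one (hC x hx)) (sq_coords_of_norm_eq_one (hC y hy))]
  simp only [Finset.sum_add_distrib]
  repeat' apply add_nonneg
  all_goals exact sum_sum_mul_nonneg C (by norm_num) _

lemma sum_legendreFive_nonneg {C : Finset E3} (hC : onSphere C) :
    0 ≤ ∑ x ∈ C, ∑ y ∈ C, legendreFive (inner ℝ x y) := by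
  rw [Finset.sum_congr rfl fun x hx => Finset.sum_congr rfl fun y hy =>
    (congrArg legendreFive (inner_eq_coords x y)).trans <| legendreFive_addition
      (sq_coords_of_norm_eq_one (hC x hx)) (sq_coords_of_norm_eq_one (hC y hy))]
  simp only [Finset.sum_add_distrib]
  repeat' apply add_nonneg
  all_goals exact sum_sum_mul_nonneg C (by norm_num) _

lemma sum_inner_smul_of_sum_legendreTwo_eq_zero {C : Finset E3} (hC : onSphere C)
    (h : ∑ x ∈ C, ∑ y ∈ C, legendreTwo (inner ℝ x y) = 0) (p : E3) :
    ∑ x ∈ C, inner ℝ p x • x = ((C.card : ℝ) / 3) • p := by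
  have hn : ∑ x ∈ C, (x 0 ^ 2 + x 1 ^ 2 + x 2 ^ 2) = C.card := by
    rw [Finset.sum_congr rfl fun x hx => sq_coords_of_norm_eq_one (hC x hx)]
    simp
  rw [sum_legendreTwo_eq hC] at h
  have vanish : ∀ {a b c d e : ℝ},
      1 / 4 * a ^ 2 + 3 * b ^ 2 + 3 * c ^ 2 + 3 / 4 * d ^ 2 + 3 / 4 * e ^ 2 = 0 →
      a = 0 ∧ b = 0 ∧ c = 0 ∧ d = 0 ∧ e = 0 := fun {a b c d e} h => by
    have := sq_nonneg a
    have := sq_nonneg b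
    have := sq_nonneg c
    have := sq_nonneg d
    have := sq_nonneg e
    refine ⟨?_, ?_, ?_, ?_, ?_⟩ <;> exact pow_eq_zero_iff two_ne_zero |>.1 (by linarith)
  obtain ⟨h22, h20, h21, h01, h10⟩ := vanish h
  simp only [mul_assoc (2 : ℝ), Finset.sum_sub_distrib, Finset.sum_add_distrib, ← Finset.mul_sum,
    Finset.sum_const, nsmul_eq_mul, mul_one] at hn h22 h01 h10
  have expand : ∀ i, (∑ x ∈ C, inner ℝ p x • x) i =
      p 0 * ∑ x ∈ C, x 0 * x i + p 1 * ∑ x ∈ C, x 1 * x i + p 2 * ∑ x ∈ C, x 2 * x i := fun i => by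
    simp only [WithLp.ofLp_sum, Finset.sum_apply, WithLp.ofLp_smul, Pi.smul_apply, smul_eq_mul,
      inner_eq_coords, Finset.mul_sum, ← Finset.sum_add_distrib]
    exact Finset.sum_congr rfl fun x _ => by ring
  have h02 : ∑ x ∈ C, x 0 * x 2 = 0 := by simpa only [mul_comm] using h20
  have h12 : ∑ x ∈ C, x 1 * x 2 = 0 := by simpa only [mul_comm] using h21
  have h10' : ∑ x ∈ C, x 1 * x 0 = 0 := by
    rw [Finset.sum_congr rfl fun x _ => mul_comm (x 1) (x 0)]; linarith
  have h01' : ∑ x ∈ C, x 0 * x 1 = 0 := by linarith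
  have hd0 : ∑ x ∈ C, x 0 * x 0 = (C.card : ℝ) / 3 := by
    simp only [← sq]; linarith
  have hd1 : ∑ x ∈ C, x 1 * x 1 = (C.card : ℝ) / 3 := by
    simp only [← sq]; linarith
  have hd2 : ∑ x ∈ C, x 2 * x 2 = (C.card : ℝ) / 3 := by
    simp only [← sq]; linarith
  ext i
  rw [expand]
  fin_cases i <;> simp [h02, h12, h10', h01', hd0, hd1, hd2, mul_comm]

lemma energy_eq {C : Finset E3} (hcard : C.card = 8) (hC : onSphere C) :
    energy cubeV C =
      1 / 2 * (∑ x ∈ C, ∑ y ∈ C,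
        if x = y then 0 else cubeV (dist x y) - interpPoly (inner ℝ x y)) +
      1 / 2 * (interpCoeffOne * ∑ x ∈ C, ∑ y ∈ C, inner ℝ x y +
        interpCoeffTwo * ∑ x ∈ C, ∑ y ∈ C, legendreTwo (inner ℝ x y) +
        interpCoeffThree * ∑ x ∈ C, ∑ y ∈ C, legendreThree (inner ℝ x y) +
        interpCoeffFive * ∑ x ∈ C, ∑ y ∈ C, legendreFive (inner ℝ x y)) +
      (32 * interpCoeffZero - 4 * interpPoly 1) := by
  have hdiag : ∑ x ∈ C, ∑ y ∈ C, (if x = y then interpPoly 1 else 0) = 8 * interpPoly 1 := by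
    simp [hcard]
  have hone : ∑ x ∈ C, ∑ y ∈ C, interpCoeffZero = 64 * interpCoeffZero := by
    simp only [Finset.sum_const, hcard, nsmul_eq_mul]
    push_cast
    ring
  have hsum : ∑ x ∈ C, ∑ y ∈ C, (if x = y then 0 else cubeV (dist x y)) +
      ∑ x ∈ C, ∑ y ∈ C, (if x = y then interpPoly 1 else 0) =
      ∑ x ∈ C, ∑ y ∈ C, (if x = y then 0 else cubeV (dist x y) - interpPoly (inner ℝ x y)) +
      ∑ x ∈ C, ∑ y ∈ C, interpPoly (inner ℝ x y) := by
    simp only [← Finset.sum_add_distrib]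
    refine Finset.sum_congr rfl fun x hx => Finset.sum_congr rfl fun y _ => ?_
    split_ifs with h
    · rw [← h, real_inner_self_eq_norm_sq, hC x hx]; norm_num
    · ring
  have hpoly : ∑ x ∈ C, ∑ y ∈ C, interpPoly (inner ℝ x y) = 64 * interpCoeffZero +
      interpCoeffOne * ∑ x ∈ C, ∑ y ∈ C, inner ℝ x y +
      interpCoeffTwo * ∑ x ∈ C, ∑ y ∈ C, legendreTwo (inner ℝ x y) +
      interpCoeffThree * ∑ x ∈ C, ∑ y ∈ C, legendreThree (inner ℝ x y) +
      interpCoeffFive * ∑ x ∈ C, ∑ y ∈ C, legendreFive (inner ℝ x y) := by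
    rw [← hone]
    simp only [interpPoly, Finset.mul_sum, ← Finset.sum_add_distrib]
  unfold energy
  linarith

lemma gap_nonneg {C : Finset E3} (hC : onSphere C) {x y : E3} (hx : x ∈ C) (hy : y ∈ C) :
    0 ≤ if x = y then 0 else cubeV (dist x y) - interpPoly (inner ℝ x y) := by
  split_ifs with h
  · rfl
  · have hle : dist x y ≤ 2 := by
      rw [dist_eq_norm]
      have := norm_sub_le x y
      rw [hC x hx, hC y hy] at this
      linarith
    rw [inner_eq_one_sub_dist_sq (hC x hx) (hC y hy), sub_nonneg]
    exact interpPoly_le_cubeV (dist_pos.2 h) hle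

lemma energy_lower_bound {C : Finset E3} (hcard : C.card = 8) (hC : onSphere C) :
    32 * interpCoeffZero - 4 * interpPoly 1 ≤ energy cubeV C := by
  obtain ⟨h1, h2, h3, h5⟩ := interpCoeff_pos
  have hgap := Finset.sum_nonneg fun x hx => Finset.sum_nonneg fun y hy => gap_nonneg hC hx hy
  have := mul_nonneg h1.le ((sum_inner_eq_norm_sq C).symm ▸ sq_nonneg ‖∑ x ∈ C, x‖)
  have := mul_nonneg h2.le (sum_legendreTwo_nonneg hC)
  have := mul_nonneg h3.le (sum_legendreThree_nonneg hC)
  have := mul_nonneg h5.le (sum_legendreFive_nonneg hC)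
  rw [energy_eq hcard hC]
  linarith

lemma design_of_energy_eq {C : Finset E3} (hcard : C.card = 8) (hC : onSphere C)
    (hE : energy cubeV C = 32 * interpCoeffZero - 4 * interpPoly 1) :
    ∑ x ∈ C, x = 0 ∧ (∀ p, ∑ x ∈ C, inner ℝ p x • x = (8 / 3 : ℝ) • p) ∧
      ∀ x ∈ C, ∀ y ∈ C, x ≠ y →
        inner ℝ x y = 1 / 3 ∨ inner ℝ x y = -1 / 3 ∨ inner ℝ x y = -1 := by
  obtain ⟨h1, h2, h3, h5⟩ := interpCoeff_pos
  have hgap := Finset.sum_nonneg fun x hx => Finset.sum_nonneg fun y hy => gap_nonneg hC hx hy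
  have k1 := mul_nonneg h1.le ((sum_inner_eq_norm_sq C).symm ▸ sq_nonneg ‖∑ x ∈ C, x‖)
  have k2 := mul_nonneg h2.le (sum_legendreTwo_nonneg hC)
  have k3 := mul_nonneg h3.le (sum_legendreThree_nonneg hC)
  have k5 := mul_nonneg h5.le (sum_legendreFive_nonneg hC)
  rw [energy_eq hcard hC] at hE
  refine ⟨?_, fun p => ?_, fun x hx y hy hxy => ?_⟩
  · have h0 : interpCoeffOne * ∑ x ∈ C, ∑ y ∈ C, inner ℝ x y = 0 := by linarith
    rw [sum_inner_eq_norm_sq] at h0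
    simpa [h1.ne'] using h0
  · have h0 : interpCoeffTwo * ∑ x ∈ C, ∑ y ∈ C, legendreTwo (inner ℝ x y) = 0 := by linarith
    have := sum_inner_smul_of_sum_legendreTwo_eq_zero hC
      ((mul_eq_zero.1 h0).resolve_left h2.ne') p
    rwa [hcard] at this
  · have h0 : ∑ x ∈ C, ∑ y ∈ C,
        (if x = y then 0 else cubeV (dist x y) - interpPoly (inner ℝ x y)) = 0 := by linarith
    rw [Finset.sum_eq_zero_iff_of_nonneg
      fun x hx => Finset.sum_nonneg fun y hy => gap_nonneg hC hx hy] at h0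
    have h0' := (Finset.sum_eq_zero_iff_of_nonneg fun y hy => gap_nonneg hC hx hy).1 (h0 x hx) y hy
    rw [if_neg hxy, sub_eq_zero] at h0'
    have hle : dist x y ≤ 2 := by
      rw [dist_eq_norm]
      have := norm_sub_le x y
      rw [hC x hx, hC y hy] at this
      linarith
    exact inner_eq_of_cubeV_eq (dist_pos.2 hxy) hle
      (inner_eq_one_sub_dist_sq (hC x hx) (hC y hy)) h0'

/-! ### Energy of the cube -/

/-- The vertex of the cube with the given signs. -/
noncomputable def cubePoint (s : Fin 3 → Bool) : E3 :=
  (WithLp.equiv 2 (Fin 3 → ℝ)).symm (fun i => (if s i then 1 else -1) / Real.sqrt 3)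

lemma cubePoint_apply (s : Fin 3 → Bool) (i : Fin 3) :
    cubePoint s i = (if s i then 1 else -1) / √3 := rfl

lemma cubeConfig_eq_image : cubeConfig = Finset.univ.image cubePoint := rfl

lemma cubeConfig_card_le : cubeConfig.card ≤ 8 :=
  Finset.card_image_le.trans (by simp)

lemma inner_cubePoint (s s' : Fin 3 → Bool) :
    inner ℝ (cubePoint s) (cubePoint s') = 1 - 2 / 3 * hammingDist s s' := by
  have h3 : √3 ^ 2 = 3 := Real.sq_sqrt (by norm_num)
  have hcoord : ∀ i, cubePoint s i * cubePoint s' i = 1 / 3 - 2 / 3 * if s i ≠ s' i then 1 else 0 :=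
    fun i => by
      rw [cubePoint_apply, cubePoint_apply, div_mul_div_comm, ← sq, h3]
      cases s i <;> cases s' i <;> norm_num
  rw [inner_eq_coords, hcoord, hcoord, hcoord, hammingDist, Finset.card_filter,
    Fin.sum_univ_three]
  push_cast
  ring

lemma norm_cubePoint (s : Fin 3 → Bool) : ‖cubePoint s‖ = 1 := by
  have h := real_inner_self_eq_norm_sq (cubePoint s)
  rw [inner_cubePoint, hammingDist_self] at h
  rw [← sq_eq_sq₀ (norm_nonneg _) zero_le_one, ← h]
  norm_num

lemma cubePoint_injective : Function.Injective cubePoint := fun s s' h => by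
  have hin := inner_cubePoint s s'
  rw [← h, real_inner_self_eq_norm_sq, norm_cubePoint] at hin
  rw [← hammingDist_eq_zero]
  exact_mod_cast (by linarith : (hammingDist s s' : ℝ) = 0)

lemma sum_hammingDist_cube (g : ℕ → ℝ) :
    ∑ s : Fin 3 → Bool, ∑ s' : Fin 3 → Bool, g (hammingDist s s') =
      8 * (g 0 + 3 * g 1 + 3 * g 2 + g 3) := by
  have hrow : ∀ s : Fin 3 → Bool, ∑ s' : Fin 3 → Bool, g (hammingDist s s') =
      g 0 + 3 * g 1 + 3 * g 2 + g 3 := fun s => by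
    rw [Finset.sum_comp g (hammingDist s)]
    have himg : Finset.univ.image (hammingDist s) = Finset.range 4 := by
      revert s; decide
    have hc : ∀ s : Fin 3 → Bool, ({s' | hammingDist s s' = 0} : Finset (Fin 3 → Bool)).card = 1 ∧
        ({s' | hammingDist s s' = 1} : Finset (Fin 3 → Bool)).card = 3 ∧
        ({s' | hammingDist s s' = 2} : Finset (Fin 3 → Bool)).card = 3 ∧
        ({s' | hammingDist s s' = 3} : Finset (Fin 3 → Bool)).card = 1 := by decide
    obtain ⟨c0, c1, c2, c3⟩ := hc s
    rw [himg]
    simp only [Finset.sum_range_succ, Finset.sum_range_zero, c0, c1, c2, c3, nsmul_eq_mul]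
    push_cast
    ring
  simp only [hrow, Finset.sum_const, Finset.card_univ, Fintype.card_fun, Fintype.card_bool,
    Fintype.card_fin, nsmul_eq_mul]
  norm_num

lemma energy_cubeConfig :
    energy cubeV cubeConfig = 32 * interpCoeffZero - 4 * interpPoly 1 := by
  have hterm : ∀ s s' : Fin 3 → Bool,
      (if cubePoint s = cubePoint s' then 0 else cubeV (dist (cubePoint s) (cubePoint s'))) =
      (fun k : ℕ => if k = 0 then 0 else interpPoly (1 - 2 / 3 * k)) (hammingDist s s') := by
    intro s s'
    by_cases h : s = s'
    · simp [h]
    · have h0 : hammingDist s s' ≠ 0 := hammingDist_ne_zero.2 h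
      have hne : cubePoint s ≠ cubePoint s' := cubePoint_injective.ne h
      have hle : hammingDist s s' ≤ 3 := by simpa using hammingDist_le_card_fintype (x := s) (y := s')
      simp only [hne, h0, if_false]
      refine cubeV_eq_interpPoly (dist_pos.2 hne) ?_ ?_
      · rw [← inner_eq_one_sub_dist_sq (norm_cubePoint s) (norm_cubePoint s'), inner_cubePoint]
      · interval_cases hammingDist s s' <;> norm_num at *
  rw [energy, cubeConfig_eq_image, Finset.sum_image cubePoint_injective.injOn]
  simp only [Finset.sum_image cubePoint_injective.injOn, hterm]
  have hsum := sum_hammingDist_cube fun k => if k = 0 then 0 else interpPoly (1 - 2 / 3 * k)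
  beta_reduce at hsum
  rw [hsum]
  norm_num [interpPoly, legendreTwo, legendreThree, legendreFive]
  ring

end Energy

/-! ### Rigidity -/

section Rigidity

local notation "E3" => EuclideanSpace ℝ (Fin 3)

lemma isOrthImage_cubeConfig_of_orthonormal {C : Finset E3} (hcard : C.card = 8) {e : Fin 3 → E3}
    (he : Orthonormal ℝ e)
    (hC : ∀ x ∈ C, ∃ s : Fin 3 → Bool, x = ∑ i, ((if s i then 1 else -1) / √3 : ℝ) • e i) :
    isOrthImage cubeConfig C := by
  obtain ⟨b, hb⟩ := Orthonormal.exists_orthonormalBasis_extension_of_card_eq (𝕜 := ℝ)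
    (by simp) (v := e) (s := Set.univ) (he.comp _ Subtype.val_injective)
  refine ⟨b.repr.symm, Finset.eq_of_subset_of_card_le (fun x hx => ?_) ?_⟩
  · obtain ⟨s, rfl⟩ := hC x hx
    rw [cubeConfig_eq_image, Finset.mem_image]
    refine ⟨cubePoint s, Finset.mem_image_of_mem _ (Finset.mem_univ s), ?_⟩
    rw [← b.sum_repr_symm]
    exact Finset.sum_congr rfl fun i _ => by rw [hb i (Set.mem_univ i), cubePoint_apply]
  · rw [hcard]
    exact Finset.card_image_le.trans cubeConfig_card_le

lemma orthonormal_pairwise_sums {y₀ y₁ y₂ : E3} (hy₀ : ‖y₀‖ = 1) (hy₁ : ‖y₁‖ = 1) (hy₂ : ‖y₂‖ = 1)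
    (h₀₁ : inner ℝ y₀ y₁ = -1 / 3) (h₀₂ : inner ℝ y₀ y₂ = -1 / 3) (h₁₂ : inner ℝ y₁ y₂ = -1 / 3) :
    Orthonormal ℝ ![(√3 / 2) • (y₁ + y₂), (√3 / 2) • (y₀ + y₂), (√3 / 2) • (y₀ + y₁)] := by
  have n₀ : inner ℝ y₀ y₀ = 1 := by rw [real_inner_self_eq_norm_sq, hy₀]; norm_num
  have n₁ : inner ℝ y₁ y₁ = 1 := by rw [real_inner_self_eq_norm_sq, hy₁]; norm_num
  have n₂ : inner ℝ y₂ y₂ = 1 := by rw [real_inner_self_eq_norm_sq, hy₂]; norm_num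
  have h₁₀ : inner ℝ y₁ y₀ = -1 / 3 := by rw [real_inner_comm, h₀₁]
  have h₂₀ : inner ℝ y₂ y₀ = -1 / 3 := by rw [real_inner_comm, h₀₂]
  have h₂₁ : inner ℝ y₂ y₁ = -1 / 3 := by rw [real_inner_comm, h₁₂]
  have h3 : √3 * √3 = 3 := Real.mul_self_sqrt (by norm_num)
  rw [orthonormal_iff_ite]
  intro i j
  fin_cases i <;> fin_cases j <;>
    simp [-inner_self_eq_norm_sq_to_K, inner_add_left, inner_add_right, real_inner_smul_left,
      real_inner_smul_right, n₀, n₁, n₂, h₀₁, h₀₂, h₁₂, h₁₀, h₂₀, h₂₁] <;> linarith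

lemma isOrthImage_cubeConfig_of_vertex {C : Finset E3} (hcard : C.card = 8) {p y₀ y₁ y₂ : E3}
    (hp_eq : p = y₀ + y₁ + y₂)
    (hy₀ : ‖y₀‖ = 1) (hy₁ : ‖y₁‖ = 1) (hy₂ : ‖y₂‖ = 1)
    (h₀ : inner ℝ p y₀ = 1 / 3) (h₁ : inner ℝ p y₁ = 1 / 3) (h₂ : inner ℝ p y₂ = 1 / 3)
    (hC : ∀ x ∈ C, x = p ∨ x = -p ∨ x = y₀ ∨ x = y₁ ∨ x = y₂ ∨ x = -y₀ ∨ x = -y₁ ∨ x = -y₂) :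
    isOrthImage cubeConfig C := by
  have n₀ : inner ℝ y₀ y₀ = 1 := by rw [real_inner_self_eq_norm_sq, hy₀]; norm_num
  have n₁ : inner ℝ y₁ y₁ = 1 := by rw [real_inner_self_eq_norm_sq, hy₁]; norm_num
  have n₂ : inner ℝ y₂ y₂ = 1 := by rw [real_inner_self_eq_norm_sq, hy₂]; norm_num
  have c₁₀ := real_inner_comm y₀ y₁
  have c₂₀ := real_inner_comm y₀ y₂
  have c₂₁ := real_inner_comm y₁ y₂
  rw [hp_eq] at h₀ h₁ h₂
  simp only [inner_add_left] at h₀ h₁ h₂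
  have h₀₁ : inner ℝ y₀ y₁ = -1 / 3 := by linarith
  have h₀₂ : inner ℝ y₀ y₂ = -1 / 3 := by linarith
  have h₁₂ : inner ℝ y₁ y₂ = -1 / 3 := by linarith
  have hk : ∀ (c : ℝ) (v : E3), (c / √3) • (√3 / 2) • v = (c / 2) • v := fun c v => by
    have : √3 ≠ 0 := by positivity
    rw [smul_smul, div_mul_div_cancel₀ this]
  have he := orthonormal_pairwise_sums hy₀ hy₁ hy₂ h₀₁ h₀₂ h₁₂
  refine isOrthImage_cubeConfig_of_orthonormal hcard he fun x hx => ?_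
  have expand : ∀ s : Fin 3 → Bool, ∑ i, ((if s i then 1 else -1) / √3 : ℝ) •
      ![(√3 / 2) • (y₁ + y₂), (√3 / 2) • (y₀ + y₂), (√3 / 2) • (y₀ + y₁)] i =
      ((if s 0 then 1 else -1) / 2 : ℝ) • (y₁ + y₂) +
      ((if s 1 then 1 else -1) / 2 : ℝ) • (y₀ + y₂) +
      ((if s 2 then 1 else -1) / 2 : ℝ) • (y₀ + y₁) := fun s => by
    rw [Fin.sum_univ_three]
    exact congrArg₂ (· + ·) (congrArg₂ (· + ·) (hk _ _) (hk _ _)) (hk _ _)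
  have signs : ∀ a b c : Bool, x = ((if a then 1 else -1) / 2 : ℝ) • (y₁ + y₂) +
      ((if b then 1 else -1) / 2 : ℝ) • (y₀ + y₂) +
      ((if c then 1 else -1) / 2 : ℝ) • (y₀ + y₁) →
      ∃ s : Fin 3 → Bool, x = ∑ i, ((if s i then 1 else -1) / √3 : ℝ) •
        ![(√3 / 2) • (y₁ + y₂), (√3 / 2) • (y₀ + y₂), (√3 / 2) • (y₀ + y₁)] i :=
    fun a b c h => ⟨![a, b, c], h.trans (expand ![a, b, c]).symm⟩
  rcases hC x hx with h | h | h | h | h | h | h | h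
  · exact signs true true true (by rw [h, hp_eq]; norm_num; module)
  · exact signs false false false (by rw [h, hp_eq]; norm_num; module)
  · exact signs false true true (by rw [h]; norm_num; module)
  · exact signs true false true (by rw [h]; norm_num; module)
  · exact signs true true false (by rw [h]; norm_num; module)
  · exact signs true false false (by rw [h]; norm_num; module)
  · exact signs false true false (by rw [h]; norm_num; module)
  · exact signs false false true (by rw [h]; norm_num; module)

lemma isOrthImage_cubeConfig_of_design {C : Finset E3} (hcard : C.card = 8) (hC : onSphere C)
    (hsum : ∑ x ∈ C, x = 0) (hframe : ∀ p, ∑ x ∈ C, inner ℝ p x • x = (8 / 3 : ℝ) • p)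
    (hinner : ∀ x ∈ C, ∀ y ∈ C, x ≠ y →
      inner ℝ x y = 1 / 3 ∨ inner ℝ x y = -1 / 3 ∨ inner ℝ x y = -1) :
    isOrthImage cubeConfig C := by
  have hvalues : ∀ p ∈ C, ∀ x ∈ C,
      x = p ∨ inner ℝ p x = 1 / 3 ∨ inner ℝ p x = -1 / 3 ∨ x = -p := fun p hp x hx => by
    by_cases h : p = x
    · exact Or.inl h.symm
    · refine Or.inr <| (hinner p hp x hx h).imp_right (Or.imp_right fun h' => ?_)
      rw [inner_eq_neg_one_iff_of_norm_eq_one (hC p hp) (hC x hx)] at h'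
      rw [h', neg_neg]
  have hself : ∀ p ∈ C, inner ℝ p p = 1 := fun p hp => by
    rw [real_inner_self_eq_norm_sq, hC p hp]; norm_num
  have hne : ∀ p ∈ C, p ≠ -p := fun p hp h => by
    have := hself p hp
    nth_rewrite 2 [h] at this
    rw [inner_neg_right, hself p hp] at this
    norm_num at this
  have partition : ∀ p ∈ C, ∀ {M : Type} [AddCommGroup M] (Φ : E3 → M), ∑ x ∈ C, Φ x =
      Φ p + ∑ x ∈ C with inner ℝ p x = 1 / 3, Φ x + ∑ x ∈ C with inner ℝ p x = -1 / 3, Φ x +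
        (if -p ∈ C then Φ (-p) else 0) := fun p hp M _ Φ => by
    have h1 : Φ p = ∑ x ∈ C, if p = x then Φ x else 0 := by simp [hp]
    have h2 : (if -p ∈ C then Φ (-p) else 0) = ∑ x ∈ C, if -p = x then Φ x else 0 := by simp
    rw [h1, h2, Finset.sum_filter, Finset.sum_filter, ← Finset.sum_add_distrib,
      ← Finset.sum_add_distrib, ← Finset.sum_add_distrib]
    refine Finset.sum_congr rfl fun x hx => ?_
    have hp1 := hC p hp
    have hpn := hne p hp
    rcases hvalues p hp x hx with rfl | h | h | rfl
    · norm_num [hp1, hpn.symm]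
    · have h1 : p ≠ x := by rintro rfl; norm_num [hp1] at h
      have h2 : -p ≠ x := by rintro rfl; norm_num [hp1] at h
      norm_num [h, h1, h2]
    · have h1 : p ≠ x := by rintro rfl; norm_num [hp1] at h
      have h2 : -p ≠ x := by rintro rfl; norm_num [hp1] at h
      norm_num [h, h1, h2]
    · norm_num [hp1, hpn]
  have counts : ∀ p ∈ C, -p ∈ C ∧ (C.filter fun x => inner ℝ p x = 1 / 3).card = 3 := fun p hp => by
    have hp1 := hself p hp
    have m0 := partition p hp fun _ => (1 : ℝ)
    have m1 := partition p hp fun x => inner ℝ p x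
    have m2 := partition p hp fun x => inner ℝ p x * inner ℝ p x
    have s1 : ∑ x ∈ C, inner ℝ p x = 0 := by rw [← inner_sum, hsum, inner_zero_right]
    have s2 : ∑ x ∈ C, inner ℝ p x * inner ℝ p x = 8 / 3 := by
      have := congrArg (inner ℝ p) (hframe p)
      simpa [inner_sum, real_inner_smul_right, hp1, hC p hp] using this
    have a1 : ∀ c : ℝ, ∑ x ∈ C with inner ℝ p x = c, inner ℝ p x =
        (C.filter fun x => inner ℝ p x = c).card * c := fun c => by
      rw [Finset.sum_congr rfl fun x hx => (Finset.mem_filter.1 hx).2]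
      simp
    have a2 : ∀ c : ℝ, ∑ x ∈ C with inner ℝ p x = c, inner ℝ p x * inner ℝ p x =
        (C.filter fun x => inner ℝ p x = c).card * (c * c) := fun c => by
      rw [Finset.sum_congr rfl fun x hx => by rw [(Finset.mem_filter.1 hx).2]]
      simp
    rw [s1, a1, a1] at m1
    rw [s2, a2, a2] at m2
    simp only [Finset.sum_const, hcard, nsmul_eq_mul, inner_neg_right, hp1] at m0 m1 m2
    by_cases h : -p ∈ C
    · refine ⟨h, ?_⟩
      simp only [h, if_true] at m0 m1 m2
      push_cast at m0
      have : ((C.filter fun x => inner ℝ p x = 1 / 3).card : ℝ) = 3 := by linarith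
      exact_mod_cast this
    · simp only [h, if_false] at m0 m1 m2
      push_cast at m0
      exfalso
      linarith
  obtain ⟨p, hp⟩ : C.Nonempty := Finset.card_pos.1 (by omega)
  obtain ⟨hneg, hthree⟩ := counts p hp
  have hp1 := hself p hp
  have hsumA : p = ∑ x ∈ C with inner ℝ p x = 1 / 3, x := by
    have m := partition p hp fun x => (3 * inner ℝ p x + 1 : ℝ) • x
    have l : ∑ x ∈ C, (3 * inner ℝ p x + 1 : ℝ) • x = (8 : ℝ) • p := by
      simp only [add_smul, mul_smul, one_smul, Finset.sum_add_distrib, ← Finset.smul_sum, hframe,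
        hsum]
      module
    have a : ∑ x ∈ C with inner ℝ p x = 1 / 3, (3 * inner ℝ p x + 1 : ℝ) • x =
        (2 : ℝ) • ∑ x ∈ C with inner ℝ p x = 1 / 3, x := by
      rw [Finset.smul_sum]
      refine Finset.sum_congr rfl fun x hx => ?_
      rw [(Finset.mem_filter.1 hx).2]
      norm_num
    have b : ∑ x ∈ C with inner ℝ p x = -1 / 3, (3 * inner ℝ p x + 1 : ℝ) • x = 0 := by
      refine Finset.sum_eq_zero fun x hx => ?_
      rw [(Finset.mem_filter.1 hx).2]
      norm_num
    rw [l, a, b, if_pos hneg, inner_neg_right, hp1] at m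
    generalize (∑ x ∈ C with inner ℝ p x = 1 / 3, x) = v at m
    have : (2 : ℝ) • p = (2 : ℝ) • v := by
      linear_combination (norm := module) m
    exact smul_right_injective E3 two_ne_zero this
  obtain ⟨y₀, y₁, y₂, h01, h02, h12, hA⟩ := Finset.card_eq_three.1 hthree
  have hmem : ∀ x, x ∈ C ∧ inner ℝ p x = 1 / 3 ↔ x = y₀ ∨ x = y₁ ∨ x = y₂ := fun x => by
    simpa using Finset.ext_iff.1 hA x
  obtain ⟨m₀, i₀⟩ := (hmem y₀).2 (by simp)
  obtain ⟨m₁, i₁⟩ := (hmem y₁).2 (by simp)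
  obtain ⟨m₂, i₂⟩ := (hmem y₂).2 (by simp)
  rw [hA, Finset.sum_insert (by simp [h01, h02]), Finset.sum_insert (by simp [h12]),
    Finset.sum_singleton, ← add_assoc] at hsumA
  refine isOrthImage_cubeConfig_of_vertex hcard hsumA (hC _ m₀) (hC _ m₁) (hC _ m₂)
    i₀ i₁ i₂ fun x hx => ?_
  rcases hvalues p hp x hx with h | h | h | h
  · exact Or.inl h
  · have := (hmem x).1 ⟨hx, h⟩
    tauto
  · have := (hmem (-x)).1 ⟨(counts x hx).1, by rw [inner_neg_right, h]; norm_num⟩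
    simp only [neg_eq_iff_eq_neg] at this
    tauto
  · exact Or.inr (Or.inl h)

end Rigidity

/-- Theorem 2: under `V(r) = 1/r³ − 1.13/r⁶ + 0.523/r⁹`, the cube is the unique global
energy minimizer among 8-point configurations on `S²`. -/
theorem cube_unique_ground_state :
    ∀ C : Finset (EuclideanSpace ℝ (Fin 3)), C.card = 8 → onSphere C →
      energy cubeV cubeConfig ≤ energy cubeV C ∧
      (energy cubeV C = energy cubeV cubeConfig → isOrthImage cubeConfig C) := by
  intro C hcard hC
  rw [energy_cubeConfig]
  refine ⟨energy_lower_bound hcard hC, fun hE => ?_⟩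
  obtain ⟨hsum, hframe, hinner⟩ := design_of_energy_eq hcard hC hE
  exact isOrthImage_cubeConfig_of_design hcard hC hsum hframe hinner
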